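/- arXiv:1802.02951 — 7 statements merged into one kernel-verified Lean document; each statement's English description precedes it below -/
import Mathlib

section
/- Let μ be a PMF on α and ν a PMF on β, and let C be a coupling of μ and ν. Suppose f : α → ℝ and g : β → ℝ satisfy f x = g y for every (x, y) in the support of C, and that g is bounded. Then E_μ[f] exists and E_μ[f] = E_ν[g]. -/
/-- Expected value of `f` under the distribution `μ`: `∑' x, (μ x).toReal * f x`. -/
noncomputable def pexp {α : Type*} (μ : PMF α) (f : α → ℝ) : ℝ :=
  ∑' x, (μ x).toReal * f x

/-- `C` is a coupling of `μ` and `ν` if its marginals are `μ` and `ν`. -/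
def IsCoupling {α β : Type*} (C : PMF (α × β)) (μ : PMF α) (ν : PMF β) : Prop :=
  C.map Prod.fst = μ ∧ C.map Prod.snd = ν

/-- Change of variables for sums against the pushforward of a PMF. -/
theorem PMF.hasSum_map_toReal_mul {γ δ : Type*} (p : PMF γ) (h : γ → δ) (φ : δ → ℝ) {s : ℝ}
    (hs : HasSum (fun c => (p c).toReal * φ (h c)) s) :
    HasSum (fun d => (p.map h d).toReal * φ d) s := by
  suffices hfiber : ∀ d, (p.map h d).toReal * φ d =
      ∑' c : h ⁻¹' {d}, (p c).toReal * φ (h c) by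
    rw [funext hfiber]
    exact hs.tsum_fiberwise h
  intro d
  have hmap : p.map h d = ∑' c : h ⁻¹' {d}, p c := by
    rw [PMF.map_apply, tsum_subtype]
    refine tsum_congr fun c => ?_
    by_cases hc : h c = d
    · simp [hc]
    · simp [hc, Ne.symm hc]
  rw [hmap, ENNReal.tsum_toReal_eq fun c : h ⁻¹' {d} => p.apply_ne_top c, ← tsum_mul_right]
  refine tsum_congr fun c => ?_
  rw [show h c = d from c.2]

/-- A bounded function is summable against a PMF. -/
theorem PMF.summable_toReal_mul {γ : Type*} (p : PMF γ) {φ : γ → ℝ} {c : ℝ}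
    (hφ : ∀ x, |φ x| ≤ c) : Summable (fun x => (p x).toReal * φ x) := by
  refine Summable.of_norm_bounded
    ((ENNReal.summable_toReal p.tsum_coe_ne_top).mul_right c) fun x => ?_
  rw [Real.norm_eq_abs, abs_mul, abs_of_nonneg ENNReal.toReal_nonneg]
  exact mul_le_mul_of_nonneg_left (hφ x) ENNReal.toReal_nonneg

/-- If `C` is a coupling of `μ` and `ν` such that `f x = g y` on the support of `C`,
and `g` is bounded, then the expectation of `f` under `μ` exists and equals the
expectation of `g` under `ν`. -/
theorem coupling_expectation_eq {α β : Type*} (μ : PMF α) (ν : PMF β) (C : PMF (α × β))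
    (hC : IsCoupling C μ ν)
    (f : α → ℝ) (g : β → ℝ)
    (hfg : ∀ p ∈ C.support, f p.1 = g p.2)
    (hg : ∃ c : ℝ, ∀ y, |g y| ≤ c) :
    Summable (fun x => (μ x).toReal * f x) ∧ pexp μ f = pexp ν g := by
  obtain ⟨rfl, rfl⟩ := hC
  obtain ⟨c, hc⟩ := hg
  have hsum := (C.summable_toReal_mul (φ := fun p => g p.2) fun p => hc p.2).hasSum
  have hcongr : (fun p => (C p).toReal * g p.2) = fun p => (C p).toReal * f p.1 := by
    funext p
    by_cases hp : p ∈ C.support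
    · rw [hfg p hp]
    · simp [(C.apply_eq_zero_iff p).2 hp]
  have hν := C.hasSum_map_toReal_mul Prod.snd g hsum
  rw [hcongr] at hsum hν
  have hμ := C.hasSum_map_toReal_mul Prod.fst f hsum
  exact ⟨hμ.summable, hμ.tsum_eq.trans hν.tsum_eq.symm⟩
end

section
/- Rule Bind for couplings: let μ : PMF α, ν : PMF β, and let C be a P-coupling of μ and ν. Let F : α → PMF α' and G : β → PMF β', and suppose that for every pair (x, y) with P x y there exists a Q-coupling of F x and G y. Then there exists a Q-coupling of μ.bind F and ν.bind G. -/
/-- `C` is a `P`-coupling of `μ` and `ν` if it is a coupling whose support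
satisfies `P`. -/
def IsPCoupling {α β : Type*} (C : PMF (α × β)) (μ : PMF α) (ν : PMF β)
    (P : α → β → Prop) : Prop :=
  IsCoupling C μ ν ∧ ∀ p ∈ C.support, P p.1 p.2

/-- Binding a `PMF` with kernels that agree on its support gives the same result. -/
theorem PMF.bind_congr_of_support {α β : Type*} (p : PMF α) {f g : α → PMF β}
    (h : ∀ a ∈ p.support, f a = g a) : p.bind f = p.bind g := by
  ext b
  simp only [PMF.bind_apply]
  refine tsum_congr fun a => ?_
  by_cases ha : p a = 0
  · simp [ha]
  · rw [h a ((p.mem_support_iff a).2 ha)]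

/-- Rule Bind for couplings: a `P`-coupling of `μ` and `ν`, together with
`Q`-couplings of `F x` and `G y` for every pair satisfying `P`, yields a
`Q`-coupling of `μ.bind F` and `ν.bind G`. -/
theorem coupling_bind {α β α' β' : Type*} (μ : PMF α) (ν : PMF β)
    (P : α → β → Prop) (Q : α' → β' → Prop)
    (C : PMF (α × β)) (hC : IsPCoupling C μ ν P)
    (F : α → PMF α') (G : β → PMF β')
    (h : ∀ x y, P x y → ∃ D : PMF (α' × β'), IsPCoupling D (F x) (G y) Q) :
    ∃ D : PMF (α' × β'), IsPCoupling D (μ.bind F) (ν.bind G) Q := by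
  obtain ⟨⟨rfl, rfl⟩, hP⟩ := hC
  have hD : ∀ p ∈ C.support, ∃ D : PMF (α' × β'), IsPCoupling D (F p.1) (G p.2) Q :=
    fun p hp => h p.1 p.2 (hP p hp)
  obtain ⟨p₀, hp₀⟩ := C.support_nonempty
  have : Nonempty (PMF (α' × β')) := ⟨(hD p₀ hp₀).choose⟩
  choose! K hK using hD
  refine ⟨C.bind K, ⟨?_, ?_⟩, ?_⟩
  · rw [PMF.map_bind, PMF.bind_map]
    exact C.bind_congr_of_support fun p hp => (hK p hp).1.1
  · rw [PMF.map_bind, PMF.bind_map]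
    exact C.bind_congr_of_support fun p hp => (hK p hp).1.2
  · intro q hq
    obtain ⟨p, hp, hqp⟩ := (PMF.mem_support_bind_iff _ _ _).1 hq
    exact (hK p hp).2 q hqp
end

section
/- Rule P-Choice for couplings: let 0 ≤ p ≤ 1 and for PMFs ρ₁ ρ₂ on a type γ write ρ₁ ⊕_p ρ₂ for the PMF whose mass function is x ↦ p * ρ₁ x + (1 − p) * ρ₂ x. If C₁ is a P-coupling of μ₁ and ν₁ and C₂ is a P-coupling of μ₂ and ν₂ (with μᵢ : PMF α, νᵢ : PMF β), then C₁ ⊕_p C₂ is a P-coupling of μ₁ ⊕_p μ₂ and ν₁ ⊕_p ν₂. -/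
open scoped ENNReal

/-- Probabilistic choice between two PMFs: with probability `p` use `μ`, with
probability `1 - p` use `ν`; the mass function is `x ↦ p * μ x + (1 - p) * ν x`. -/
noncomputable def pchoice {α : Type*} (p : ℝ) (hp0 : 0 ≤ p) (hp1 : p ≤ 1)
    (μ ν : PMF α) : PMF α :=
  ⟨fun x => ENNReal.ofReal p * μ x + ENNReal.ofReal (1 - p) * ν x, by
    have h : HasSum (fun x => ENNReal.ofReal p * μ x + ENNReal.ofReal (1 - p) * ν x)
        (∑' x, (ENNReal.ofReal p * μ x + ENNReal.ofReal (1 - p) * ν x)) :=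
      ENNReal.summable.hasSum
    have hval : ∑' x, (ENNReal.ofReal p * μ x + ENNReal.ofReal (1 - p) * ν x) = 1 := by
      rw [ENNReal.tsum_add, ENNReal.tsum_mul_left, ENNReal.tsum_mul_left,
        μ.tsum_coe, ν.tsum_coe, mul_one, mul_one,
        ← ENNReal.ofReal_add hp0 (by linarith)]
      have hps : p + (1 - p) = 1 := by ring
      rw [hps, ENNReal.ofReal_one]
    exact hval ▸ h⟩

theorem pchoice_apply {α : Type*} (p : ℝ) (hp0 : 0 ≤ p) (hp1 : p ≤ 1) (μ ν : PMF α) (x : α) :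
    pchoice p hp0 hp1 μ ν x = ENNReal.ofReal p * μ x + ENNReal.ofReal (1 - p) * ν x :=
  rfl

theorem map_pchoice {α β : Type*} (f : α → β) (p : ℝ) (hp0 : 0 ≤ p) (hp1 : p ≤ 1)
    (μ ν : PMF α) :
    (pchoice p hp0 hp1 μ ν).map f = pchoice p hp0 hp1 (μ.map f) (ν.map f) := by
  classical
  ext b
  simp only [pchoice_apply, PMF.map_apply, ← ENNReal.tsum_mul_left, ← ENNReal.tsum_add]
  refine tsum_congr fun a => ?_
  split_ifs <;> simp

theorem support_pchoice_subset {α : Type*} (p : ℝ) (hp0 : 0 ≤ p) (hp1 : p ≤ 1)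
    (μ ν : PMF α) :
    (pchoice p hp0 hp1 μ ν).support ⊆ μ.support ∪ ν.support := by
  intro x hx
  by_contra h
  simp only [Set.mem_union, PMF.mem_support_iff, not_or, not_not] at h
  exact hx (by simp [pchoice_apply, h.1, h.2])

/-- Rule P-Choice for couplings: the `p`-probabilistic choice of a `P`-coupling of
`μ₁, ν₁` and a `P`-coupling of `μ₂, ν₂` is a `P`-coupling of the choices. -/
theorem coupling_pchoice {α β : Type*} (p : ℝ) (hp0 : 0 ≤ p) (hp1 : p ≤ 1)
    (μ₁ μ₂ : PMF α) (ν₁ ν₂ : PMF β) (P : α → β → Prop)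
    (C₁ C₂ : PMF (α × β))
    (h₁ : IsPCoupling C₁ μ₁ ν₁ P) (h₂ : IsPCoupling C₂ μ₂ ν₂ P) :
    IsPCoupling (pchoice p hp0 hp1 C₁ C₂)
      (pchoice p hp0 hp1 μ₁ μ₂) (pchoice p hp0 hp1 ν₁ ν₂) P := by
  obtain ⟨⟨hμ₁, hν₁⟩, hP₁⟩ := h₁
  obtain ⟨⟨hμ₂, hν₂⟩, hP₂⟩ := h₂
  refine ⟨⟨?_, ?_⟩, fun x hx => ?_⟩
  · rw [map_pchoice, hμ₁, hμ₂]
  · rw [map_pchoice, hν₁, hν₂]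
  · exact (support_pchoice_subset p hp0 hp1 C₁ C₂ hx).elim (hP₁ x) (hP₂ x)
end

section
/- Theorem (coupling bound): let 𝓘 be a nonempty set of PMFs on T, let f : α → ℝ and g : T → ℝ, and suppose g is bounded on the support of 𝓘 by some c. Let μ : PMF α, and suppose there exists ν : PMF T such that (i) for every bounded h : T → ℝ, E_ν[h] ≤ Ex_max h 𝓘, and (ii) there exists a P-coupling of μ and ν with P x y := (f x = g y). Then E_μ[f] exists and Ex_min g 𝓘 ≤ E_μ[f] ≤ Ex_max g 𝓘. -/
/-- A real-valued function is bounded if its absolute value is uniformly bounded. -/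
def Bounded {α : Type*} (f : α → ℝ) : Prop := ∃ c : ℝ, ∀ x, |f x| ≤ c

/-- The support of a nondeterministic probabilistic computation, modeled as a set
of PMFs: the union of the supports of its members. -/
def psupport {T : Type*} (I : Set (PMF T)) : Set T := ⋃ ν ∈ I, ν.support

/-- Minimal expected value of `f` over the set of distributions `I`. -/
noncomputable def exMin {T : Type*} (f : T → ℝ) (I : Set (PMF T)) : ℝ :=
  ⨅ ν : I, pexp ν.1 f

/-- Maximal expected value of `f` over the set of distributions `I`. -/
noncomputable def exMax {T : Type*} (f : T → ℝ) (I : Set (PMF T)) : ℝ :=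
  ⨆ ν : I, pexp ν.1 f

namespace PMF

variable {α β : Type*}

theorem summable_toReal (μ : PMF α) : Summable fun x => (μ x).toReal :=
  ENNReal.summable_toReal (by simp [μ.tsum_coe])

/-- A function bounded on the support of a PMF has a summable expectation. -/
theorem summable_toReal_mul_of_bounded (μ : PMF α) {f : α → ℝ} {c : ℝ}
    (hf : ∀ x ∈ μ.support, |f x| ≤ c) : Summable fun x => (μ x).toReal * f x := by
  refine Summable.of_norm_bounded (g := fun x => (μ x).toReal * c)
    (μ.summable_toReal.mul_right c) fun x => ?_
  rw [norm_mul, Real.norm_eq_abs, Real.norm_eq_abs, abs_of_nonneg ENNReal.toReal_nonneg]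
  by_cases hx : x ∈ μ.support
  · exact mul_le_mul_of_nonneg_left (hf x hx) ENNReal.toReal_nonneg
  · simp [(μ.apply_eq_zero_iff x).2 hx]

theorem pexp_congr {μ : PMF α} {f g : α → ℝ} (h : ∀ x ∈ μ.support, f x = g x) :
    pexp μ f = pexp μ g := by
  refine tsum_congr fun x => ?_
  by_cases hx : x ∈ μ.support
  · rw [h x hx]
  · simp [(μ.apply_eq_zero_iff x).2 hx]

theorem pexp_neg (μ : PMF α) (f : α → ℝ) : pexp μ (fun x => -f x) = -pexp μ f := by
  simp [pexp, tsum_neg]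

open MeasureTheory in
/-- Change of variables for expectations of functions bounded on the support. -/
theorem pexp_map (μ : PMF α) (φ : α → β) {f : β → ℝ} {c : ℝ}
    (hf : ∀ x ∈ μ.support, |f (φ x)| ≤ c) : pexp (μ.map φ) f = pexp μ (f ∘ φ) := by
  let f' : β → ℝ := (φ '' μ.support).indicator f
  have hc : ∀ y, ‖f' y‖ ≤ |c| := fun y => by
    by_cases hy : y ∈ φ '' μ.support
    · obtain ⟨x, hx, rfl⟩ := hy
      simpa [f', Set.mem_image_of_mem φ hx] using (hf x hx).trans (le_abs_self c)
    · simp [f', hy]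
  rw [pexp_congr (g := f') (fun y hy => ?_), pexp_congr (f := f ∘ φ) (g := f' ∘ φ) (fun x hx => ?_)]
  · let _ : MeasurableSpace α := ⊤
    let _ : MeasurableSpace β := ⊤
    have hi : Integrable f' (μ.map φ).toMeasure :=
      Integrable.of_bound measurable_from_top.aestronglyMeasurable |c| (ae_of_all _ hc)
    have hi' : Integrable (f' ∘ φ) μ.toMeasure :=
      Integrable.of_bound measurable_from_top.aestronglyMeasurable |c|
        (ae_of_all _ fun x => hc (φ x))
    have e := PMF.integral_eq_tsum (μ.map φ) f' hi
    have e' := PMF.integral_eq_tsum μ (f' ∘ φ) hi'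
    rw [← PMF.toMeasure_map φ μ measurable_from_top,
      integral_map measurable_from_top.aemeasurable
        measurable_from_top.aestronglyMeasurable] at e
    exact e.symm.trans e'
  · exact (Set.indicator_of_mem (Set.mem_image_of_mem φ hx) f).symm
  · rw [PMF.support_map] at hy
    exact (Set.indicator_of_mem hy f).symm

end PMF

theorem PMF.support_subset_psupport {T : Type*} {I : Set (PMF T)} {ν : PMF T} (hν : ν ∈ I) :
    ν.support ⊆ psupport I :=
  Set.subset_biUnion_of_mem (u := fun ν : PMF T => ν.support) hν

theorem exMax_congr {T : Type*} {I : Set (PMF T)} {f g : T → ℝ}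
    (h : ∀ t ∈ psupport I, f t = g t) : exMax f I = exMax g I :=
  iSup_congr fun ν => PMF.pexp_congr fun t ht => h t (PMF.support_subset_psupport ν.2 ht)

theorem exMax_neg {T : Type*} (I : Set (PMF T)) (f : T → ℝ) :
    exMax (fun t => -f t) I = -exMin f I := by
  simp only [exMax, exMin, PMF.pexp_neg, iSup, iInf, Real.sInf_def]
  rw [neg_neg]
  congr 1
  ext x
  simp [neg_eq_iff_eq_neg]

/-- A PMF whose expectations of bounded functions are dominated by the maximal expectations over
`I` is supported in the support of `I`. -/
theorem PMF.support_subset_psupport_of_le_exMax {T : Type*} {I : Set (PMF T)} {ν : PMF T}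
    (h : ∀ f : T → ℝ, Bounded f → pexp ν f ≤ exMax f I) : ν.support ⊆ psupport I := by
  intro t ht
  by_contra hI
  let f : T → ℝ := (psupport I)ᶜ.indicator 1
  have hf : ∀ x, |f x| ≤ 1 := fun x => by
    by_cases hx : x ∈ psupport I <;> simp [f, hx]
  have hf0 : ∀ x, 0 ≤ f x := fun x => Set.indicator_nonneg (fun _ _ => zero_le_one) x
  have hmax : exMax f I = 0 := by
    rw [exMax_congr (g := fun _ => 0) fun x hx => by simp [f, hx]]
    simp [exMax, pexp]
  have hle : (ν t).toReal * f t ≤ pexp ν f :=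
    (ν.summable_toReal_mul_of_bounded fun x _ => hf x).le_tsum t
      fun x _ => mul_nonneg ENNReal.toReal_nonneg (hf0 x)
  have hpos : 0 < (ν t).toReal :=
    ENNReal.toReal_pos ((ν.mem_support_iff t).1 ht) (ν.apply_ne_top t)
  have hft : f t = 1 := by simp [f, hI]
  rw [hft, mul_one] at hle
  linarith [h f ⟨1, hf⟩]

/-- Coupling bound: if `g` is bounded on the support of the nonempty set `I` of
PMFs, and there is some `ν` whose expectations on bounded functions are dominated
by the maximal expectations over `I`, together with a coupling of `μ` and `ν`
relating `f` and `g` on its support, then the expectation of `f` under `μ` exists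
and is sandwiched between the extrema of expectations of `g` over `I`. -/
theorem coupling_bound {α T : Type*} (I : Set (PMF T)) (hne : I.Nonempty)
    (f : α → ℝ) (g : T → ℝ) (c : ℝ) (hg : ∀ t ∈ psupport I, |g t| ≤ c)
    (μ : PMF α)
    (h : ∃ ν : PMF T,
      (∀ h' : T → ℝ, Bounded h' → pexp ν h' ≤ exMax h' I) ∧
      ∃ C : PMF (α × T), IsCoupling C μ ν ∧ ∀ p ∈ C.support, f p.1 = g p.2) :
    Summable (fun x => (μ x).toReal * f x) ∧
    exMin g I ≤ pexp μ f ∧ pexp μ f ≤ exMax g I := by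
  obtain ⟨ν, hν, C, ⟨rfl, rfl⟩, hC⟩ := h
  have hsub := PMF.support_subset_psupport_of_le_exMax hν
  have hgC : ∀ p ∈ C.support, |g p.2| ≤ c := fun p hp =>
    hg _ (hsub (by rw [PMF.support_map]; exact Set.mem_image_of_mem _ hp))
  have hfC : ∀ p ∈ C.support, |f p.1| ≤ c := fun p hp => hC p hp ▸ hgC p hp
  have hfg : pexp (C.map Prod.fst) f = pexp (C.map Prod.snd) g := by
    rw [PMF.pexp_map C _ hfC, PMF.pexp_map C _ hgC]
    exact PMF.pexp_congr hC
  let g' : T → ℝ := (psupport I).indicator g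
  have hg' : ∀ t, |g' t| ≤ |c| := fun t => by
    by_cases ht : t ∈ psupport I
    · simpa [g', ht] using (hg t ht).trans (le_abs_self c)
    · simp [g', ht]
  have hgg' : ∀ t ∈ psupport I, g' t = g t := fun t ht => Set.indicator_of_mem ht g
  have hνg : pexp (C.map Prod.snd) g' = pexp (C.map Prod.snd) g :=
    PMF.pexp_congr fun t ht => hgg' t (hsub ht)
  refine ⟨PMF.summable_toReal_mul_of_bounded _ (c := c) fun x hx => ?_, ?_, ?_⟩
  · rw [PMF.support_map] at hx
    obtain ⟨p, hp, rfl⟩ := hx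
    exact hfC p hp
  · have hneg := hν (fun t => -g' t) ⟨|c|, fun t => by simpa using hg' t⟩
    rw [PMF.pexp_neg, hνg, exMax_congr (g := fun t => -g t) fun t ht => by rw [hgg' t ht],
      exMax_neg] at hneg
    rw [hfg]
    exact neg_le_neg_iff.1 hneg
  · rw [hfg, ← hνg, ← exMax_congr hgg']
    exact hν g' ⟨|c|, hg'⟩
end

section
/- Let 𝓘 and 𝓘' be nonempty sets of PMFs on T with 𝓘 ⊆_p 𝓘'. Then the support of 𝓘 is contained in the support of 𝓘', i.e. ⋃_{ν ∈ 𝓘} ν.support ⊆ ⋃_{ν' ∈ 𝓘'} ν'.support. -/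
/-- `I ⊆ₚ I'`: for every bounded function, the maximal expected value over `I` is
at most that over `I'`. -/
def SubsetP {T : Type*} (I I' : Set (PMF T)) : Prop :=
  ∀ f : T → ℝ, Bounded f → exMax f I ≤ exMax f I'

/-- The expectation of the indicator function of `{x}` is the probability of `x`. -/
theorem pexp_indicator_singleton {α : Type*} (μ : PMF α) (x : α) :
    pexp μ (Set.indicator {x} 1) = (μ x).toReal := by
  unfold pexp
  rw [tsum_eq_single x (fun y hy => by simp [hy])]
  simp

theorem bounded_indicator_one {α : Type*} (s : Set α) :
    Bounded (Set.indicator s (1 : α → ℝ)) := by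
  classical
  refine ⟨1, fun y => ?_⟩
  rw [Set.indicator_apply]
  split_ifs <;> simp

/-- If `I ⊆ₚ I'`, then the support of `I` is contained in the support of `I'`. -/
theorem subsetP_support_subset {T : Type*} (I I' : Set (PMF T))
    (hI : I.Nonempty) (hI' : I'.Nonempty) (h : SubsetP I I') :
    psupport I ⊆ psupport I' := by
  intro x hx
  simp only [psupport, Set.mem_iUnion, PMF.mem_support_iff] at hx ⊢
  obtain ⟨ν, hν, hνx⟩ := hx
  by_contra! hx'
  have hle := h _ (bounded_indicator_one {x})
  simp only [exMax, pexp_indicator_singleton] at hle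
  have hzero : (⨆ μ : I', (μ.1 x).toReal) = 0 := by
    simp [fun μ : I' => hx' μ.1 μ.2]
  have hbdd : BddAbove (Set.range fun μ : I => (μ.1 x).toReal) :=
    ⟨1, by
      rintro _ ⟨μ, rfl⟩
      exact ENNReal.toReal_le_of_le_ofReal zero_le_one (by simpa using μ.1.coe_le_one x)⟩
  have hpos : 0 < (ν x).toReal := ENNReal.toReal_pos hνx (ν.apply_ne_top x)
  have hsup := le_ciSup hbdd ⟨ν, hν⟩
  dsimp only at hsup
  linarith
end

section
/- Non-idempotence of probabilistic choice for indexed valuations: let ι be a countable type, v : ι → ℝ≥0 with ∑' i, v i = 1, d : ι → T, and let 0 < p < 1. Define the indexed valuation on ι ⊕ ι by v' (inl i) = p * v i, v' (inr i) = (1 − p) * v i, and d' (inl i) = d' (inr i) = d i. Then there is no bijection h from {x : ι ⊕ ι | v' x ≠ 0} to {i : ι | v i ≠ 0} such that v (h x) = v' x and d (h x) = d' x for all x; that is, the p-choice of an indexed valuation with itself is not equivalent to itself. -/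
open scoped NNReal

/-- A summable family of nonnegative reals with a nonzero term attains a positive maximum. -/
theorem NNReal.exists_pos_forall_le_of_summable {ι : Type*} {v : ι → ℝ≥0} (hv : Summable v)
    (hne : ∃ i, v i ≠ 0) : ∃ i, 0 < v i ∧ ∀ j, v j ≤ v i := by
  obtain ⟨k, hk⟩ := hne
  have hk : 0 < v k := pos_iff_ne_zero.mpr hk
  have hfin : {i | v k ≤ v i}.Finite := by
    have h := (NNReal.tendsto_cofinite_zero_of_summable hv).eventually_lt_const hk
    simpa [Filter.eventually_cofinite] using h
  obtain ⟨i, hi, hmax⟩ := Set.exists_max_image _ v hfin ⟨k, le_refl (v k)⟩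
  refine ⟨i, hk.trans_le hi, fun j => ?_⟩
  rcases le_total (v k) (v j) with hj | hj
  · exact hmax j hj
  · exact hj.trans hi

/-- Non-idempotence of probabilistic choice for indexed valuations: for
`0 < p < 1`, the `p`-probabilistic choice of an indexed valuation `(ι, d, v)`
with itself (an indexed valuation on `ι ⊕ ι` scaling `v` by `p` on the left and
by `1 - p` on the right, with decoding inherited) admits no bijection of indicial
supports onto that of `(ι, d, v)` preserving the values and decodings; i.e. it is
not equivalent to `(ι, d, v)`. -/
theorem pchoice_self_not_equiv {T ι : Type*} [Countable ι]
    (v : ι → ℝ≥0) (d : ι → T) (hv : ∑' i, v i = 1)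
    (p : ℝ≥0) (hp0 : 0 < p) (hp1 : p < 1) :
    ¬ ∃ h : {x : ι ⊕ ι // Sum.elim (fun i => p * v i) (fun i => (1 - p) * v i) x ≠ 0} ≃
            {i : ι // v i ≠ 0},
        (∀ x, v (h x) = Sum.elim (fun i => p * v i) (fun i => (1 - p) * v i) x.1) ∧
        (∀ x, d (h x) = Sum.elim d d x.1) := by
  rintro ⟨h, hval, -⟩
  have hsum : Summable v := by
    by_contra hns
    simp [tsum_eq_zero_of_not_summable hns] at hv
  have hne : ∃ i, v i ≠ 0 := by
    by_contra! h0
    simp [h0] at hv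
  obtain ⟨i, hi, hmax⟩ := NNReal.exists_pos_forall_le_of_summable hsum hne
  have hq1 : 1 - p < 1 := tsub_lt_self one_pos hp0
  have key : ∀ q : ℝ≥0, q < 1 → ∀ j, v i ≠ q * v j := fun q hq j =>
    ((mul_le_mul_right (hmax j) q).trans_lt (mul_lt_of_lt_one_left hi hq)).ne'
  obtain ⟨⟨x, hx⟩, hxi⟩ := h.surjective ⟨i, hi.ne'⟩
  have hvx := hval ⟨x, hx⟩
  rw [hxi] at hvx
  rcases x with j | j
  · exact key p hp1 j hvx
  · exact key (1 - p) hq1 j hvx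
end

section
/- Expected search cost in the two-level skip list: fix integers INTMIN and INTMAX and a finite set of integers S with INTMIN < i < INTMAX for every i ∈ S, and fix a key k with INTMIN < k < INTMAX. For finite sets of integers tl, bl define: topcost(tl, k) = 1 + |{i ∈ tl | INTMIN < i < k}|; rettop(tl, k) = max({i ∈ tl | i < k} ∪ {INTMIN}); botcost(tl, bl, k) = 1 + |{i ∈ bl | rettop(tl, k) < i < k}|; and skipcost(tl, bl, k) = topcost(tl, k) if k ∈ tl, and topcost(tl, k) + botcost(tl, bl, k) otherwise. Let n = |{i ∈ S | i < k}|, and let T be drawn uniformly at random from the powerset of S (each key independently placed in the top list with probability 1/2). Then the expected value of skipcost(T, S, k) is at most 1 + n/2 + 2·(1 − 1/2^{n+1}). -/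
/-- Number of key comparisons made while searching for `k` in the top list `tl`
(with left sentinel `INTMIN`). -/
def topcost (INTMIN : ℤ) (tl : Finset ℤ) (k : ℤ) : ℕ :=
  1 + (tl.filter fun i => INTMIN < i ∧ i < k).card

/-- The largest key of the top list `tl` strictly below `k` (or the sentinel
`INTMIN` if there is none): the node from which the bottom-list search starts. -/
def rettop (INTMIN : ℤ) (tl : Finset ℤ) (k : ℤ) : ℤ :=
  (insert INTMIN (tl.filter fun i => i < k)).max' (Finset.insert_nonempty _ _)

/-- Number of key comparisons made while searching for `k` in the bottom list
`bl`, starting from `rettop INTMIN tl k`. -/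
def botcost (INTMIN : ℤ) (tl bl : Finset ℤ) (k : ℤ) : ℕ :=
  1 + (bl.filter fun i => rettop INTMIN tl k < i ∧ i < k).card

/-- Total number of key comparisons made while searching for `k` in the two-level
skip list with top list `tl` and bottom list `bl`. -/
def skipcost (INTMIN : ℤ) (tl bl : Finset ℤ) (k : ℤ) : ℕ :=
  if k ∈ tl then topcost INTMIN tl k
  else topcost INTMIN tl k + botcost INTMIN tl bl k

/-- The expectation of `f` under the uniform distribution on `s` is its average over `s`. -/
theorem tsum_uniformOfFinset_toReal_mul {α : Type*} {s : Finset α} (hs : s.Nonempty)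
    (f : α → ℝ) :
    ∑' a, (PMF.uniformOfFinset s hs a).toReal * f a = (s.card : ℝ)⁻¹ * ∑ a ∈ s, f a := by
  rw [tsum_eq_sum (s := s) fun a ha => by
    rw [PMF.uniformOfFinset_apply_of_notMem hs ha, ENNReal.toReal_zero, zero_mul], Finset.mul_sum]
  refine Finset.sum_congr rfl fun a ha => ?_
  rw [PMF.uniformOfFinset_apply_of_mem hs ha, ENNReal.toReal_inv, ENNReal.toReal_natCast]

open Finset in
/-- The numbers of elements of `L` that are at least `i` run through `1, …, #L` as `i` runs
through `L`, so the corresponding powers of `1 / 2` form a geometric sum. -/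
theorem sum_half_pow_card_filter_le (L : Finset ℤ) :
    ∑ i ∈ L, (1 / 2 : ℝ) ^ #{j ∈ L | i ≤ j} = 1 - (1 / 2) ^ #L := by
  induction L using Finset.induction_on_min with
  | empty => simp
  | insert a L ha ih =>
    have hmem : a ∉ L := fun h => (ha a h).false
    rw [sum_insert hmem, filter_true_of_mem, card_insert_of_notMem hmem]
    · have hL : ∀ i ∈ L, {j ∈ insert a L | i ≤ j} = {j ∈ L | i ≤ j} := fun i hi => by
        rw [filter_insert, if_neg (ha i hi).not_ge]
      rw [sum_congr rfl fun i hi => by rw [hL i hi], ih]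
      ring
    · intro j hj
      rcases mem_insert.1 hj with rfl | hj
      · exact le_rfl
      · exact (ha j hj).le

open Finset in
/-- A uniformly random subset of `S` avoids `A ⊆ S` with probability `2⁻¹ ^ #A`. -/
theorem card_powerset_filter_disjoint {α : Type*} [DecidableEq α] {S A : Finset α} (hA : A ⊆ S) :
    (#{T ∈ S.powerset | Disjoint T A} : ℝ) = 2 ^ #S * (1 / 2) ^ #A := by
  have h : {T ∈ S.powerset | Disjoint T A} = (S \ A).powerset := by
    ext T
    simp [subset_sdiff]
  rw [h, card_powerset, card_sdiff_of_subset hA]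
  push_cast
  rw [pow_sub₀ _ two_ne_zero (card_le_card hA), one_div, inv_pow]

open Finset in
/-- A uniformly random subset of `S` contains `i ∈ S` with probability `1 / 2`. -/
theorem card_powerset_filter_mem {α : Type*} [DecidableEq α] {S : Finset α} {i : α} (hi : i ∈ S) :
    (#{T ∈ S.powerset | i ∈ T} : ℝ) = 2 ^ #S * (1 / 2) := by
  have h := card_powerset_filter_disjoint (singleton_subset_iff.2 hi)
  have h' := card_filter_add_card_filter_not (s := S.powerset) (fun T => i ∈ T)
  simp only [disjoint_singleton_right, card_singleton, pow_one] at h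
  rw [card_powerset] at h'
  have h'' : (#{T ∈ S.powerset | i ∈ T} : ℝ) + #{T ∈ S.powerset | i ∉ T} = 2 ^ #S := by
    exact_mod_cast h'
  linarith

open Finset in
/-- The search cost in terms of the keys of `S` below `k`: those in the top list, and those that
have no top-list key between them and `k`. -/
theorem skipcost_le {INTMIN k : ℤ} {S T : Finset ℤ} (hT : T ⊆ S) :
    skipcost INTMIN T S k ≤ 2 + #{i ∈ S.filter (· < k) | i ∈ T} +
      #{i ∈ S.filter (· < k) | Disjoint T {j ∈ S.filter (· < k) | i ≤ j}} := by
  have htop : #{i ∈ T | INTMIN < i ∧ i < k} ≤ #{i ∈ S.filter (· < k) | i ∈ T} := by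
    refine card_le_card fun i hi => ?_
    simp only [mem_filter] at hi ⊢
    exact ⟨⟨hT hi.1, hi.2.2⟩, hi.1⟩
  have hbot : #{i ∈ S | rettop INTMIN T k < i ∧ i < k} ≤
      #{i ∈ S.filter (· < k) | Disjoint T {j ∈ S.filter (· < k) | i ≤ j}} := by
    refine card_le_card fun i hi => ?_
    simp only [mem_filter] at hi ⊢
    refine ⟨⟨hi.1, hi.2.2⟩, disjoint_left.2 fun j hjT hj => ?_⟩
    simp only [mem_filter] at hj
    have hj' : j ≤ rettop INTMIN T k :=
      le_max' _ _ (mem_insert_of_mem (mem_filter.2 ⟨hjT, hj.1.2⟩))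
    omega
  unfold skipcost topcost botcost
  split_ifs <;> omega

open Finset in
theorem sum_powerset_card_filter {α β : Type*} (S : Finset α) (L : Finset β)
    (r : Finset α → β → Prop) [∀ T i, Decidable (r T i)] :
    ∑ T ∈ S.powerset, (#{i ∈ L | r T i} : ℝ) = ∑ i ∈ L, (#{T ∈ S.powerset | r T i} : ℝ) := by
  exact_mod_cast sum_card_bipartiteAbove_eq_sum_card_bipartiteBelow r

open Finset in
theorem sum_powerset_skipcost_le (INTMIN k : ℤ) (S : Finset ℤ) :
    ∑ T ∈ S.powerset, (skipcost INTMIN T S k : ℝ) ≤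
      2 ^ #S * (2 + #(S.filter (· < k)) / 2 + (1 - (1 / 2) ^ #(S.filter (· < k)))) := by
  set L := S.filter (· < k)
  have hLS : L ⊆ S := filter_subset _ _
  calc ∑ T ∈ S.powerset, (skipcost INTMIN T S k : ℝ)
      ≤ ∑ T ∈ S.powerset, ((2 : ℝ) + #{i ∈ L | i ∈ T} +
          #{i ∈ L | Disjoint T {j ∈ L | i ≤ j}}) :=
        sum_le_sum fun T hT => by exact_mod_cast skipcost_le (mem_powerset.1 hT)
    _ = 2 ^ #S * 2 + ∑ i ∈ L, (2 ^ #S * (1 / 2) : ℝ) +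
          ∑ i ∈ L, 2 ^ #S * (1 / 2 : ℝ) ^ #{j ∈ L | i ≤ j} := by
        rw [sum_add_distrib, sum_add_distrib, sum_powerset_card_filter, sum_powerset_card_filter,
          sum_congr rfl fun i hi => card_powerset_filter_mem (hLS hi),
          sum_congr rfl fun i _ => card_powerset_filter_disjoint ((filter_subset _ L).trans hLS)]
        simp
    _ = _ := by
        rw [← mul_sum (s := L) (f := fun i => (1 / 2 : ℝ) ^ #{j ∈ L | i ≤ j}), sum_half_pow_card_filter_le, sum_const, nsmul_eq_mul]
        ring

/-- Expected search cost in the two-level skip list: with all keys of `S` (and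
the search key `k`) strictly between the sentinels `INTMIN` and `INTMAX`, with
`n` the number of keys of `S` below `k`, and with the top list `T` drawn
uniformly from the powerset of `S`, the expected number of comparisons when
searching for `k` is at most `1 + n/2 + 2·(1 - 1/2^(n+1))`. -/
theorem skiplist_expected_cost (INTMIN INTMAX : ℤ) (S : Finset ℤ)
    (hS : ∀ i ∈ S, INTMIN < i ∧ i < INTMAX)
    (k : ℤ) (hk : INTMIN < k ∧ k < INTMAX)
    (n : ℕ) (hn : (S.filter fun i => i < k).card = n) :
    ∑' T : Finset ℤ,
      ((PMF.uniformOfFinset S.powerset ⟨∅, Finset.empty_mem_powerset S⟩) T).toReal *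
        (skipcost INTMIN T S k : ℝ)
      ≤ 1 + (n : ℝ) / 2 + 2 * (1 - 1 / 2 ^ (n + 1)) := by
  subst hn
  refine (tsum_uniformOfFinset_toReal_mul _ fun T => (skipcost INTMIN T S k : ℝ)).trans_le ?_
  rw [Finset.card_powerset, Nat.cast_pow, Nat.cast_ofNat, inv_mul_le_iff₀ (by positivity)]
  refine (sum_powerset_skipcost_le INTMIN k S).trans_eq ?_
  rw [← one_div_pow, pow_succ]
  ring
end
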